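/- Let K be a number field with ring of integers 𝓞_K. For every real s > 1, ∑_{𝔭} N(𝔭)^{-s} = ∑_{n=1}^{∞} (μ(n)/n) · log( ∑_{I ≠ 0} N(I)^{-ns} ), where the sum on the left runs over all nonzero prime ideals 𝔭 of 𝓞_K, the inner sum on the right runs over all nonzero ideals I of 𝓞_K (this Dedekind zeta series converges to a positive real number since ns > 1), μ is the Möbius function, and log is the real logarithm; in particular both series converge. -/

import Mathlib

open NumberField

/-- Summing a completely multiplicative function over the ideals prime to a finite set of primes. -/
theorem Ideal.tsum_indicator_not_dvd_eq_prod_mul_tsum {R : Type*} [CommRing R] [IsDedekindDomain R]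
    (f : Ideal R →*₀ ℝ) (hf : Summable f) (S : Finset {p : Ideal R // p.IsPrime ∧ p ≠ ⊥}) :
    ∑' I, {I : Ideal R | ∀ p ∈ S, ¬ p.1 ∣ I}.indicator f I =
      (∏ p ∈ S, (1 - f p.1)) * ∑' I, f I := by
  classical
  induction S using Finset.induction_on with
  | empty => simp
  | insert p S hp ih =>
    set A : Set (Ideal R) := {I : Ideal R | ∀ p ∈ S, ¬ p.1 ∣ I}
    have hmul : ∀ J, p.1 * J ∈ A ↔ J ∈ A := fun J ↦ by
      refine forall₂_congr fun q hq ↦ not_congr ⟨fun h ↦ ?_, fun h ↦ h.mul_left _⟩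
      refine ((Ideal.prime_of_isPrime q.2.2 q.2.1).dvd_or_dvd h).resolve_left fun hqp ↦ hp ?_
      have := (Ideal.prime_of_isPrime q.2.2 q.2.1).associated_of_dvd
        (Ideal.prime_of_isPrime p.2.2 p.2.1) hqp
      rwa [← Subtype.ext (associated_iff_eq.mp this)]
    have hsplit : ∀ I, A.indicator f I =
        {I : Ideal R | ∀ q ∈ insert p S, ¬ q.1 ∣ I}.indicator f I +
          (A ∩ {I | p.1 ∣ I}).indicator f I := fun I ↦ by
      have hins : I ∈ {I : Ideal R | ∀ q ∈ insert p S, ¬ q.1 ∣ I} ↔ ¬ p.1 ∣ I ∧ I ∈ A :=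
        Finset.forall_mem_insert _ _ _
      have hinter : I ∈ A ∩ {I | p.1 ∣ I} ↔ I ∈ A ∧ p.1 ∣ I := Iff.rfl
      simp only [Set.indicator_apply, hins, hinter]
      by_cases h₁ : I ∈ A <;> by_cases h₂ : p.1 ∣ I <;> simp only [h₁, h₂] <;> simp
    have hdvd : ∑' I, (A ∩ {I | p.1 ∣ I}).indicator f I = f p.1 * ∑' I, A.indicator f I := by
      have hinj : Function.Injective fun J : Ideal R ↦ p.1 * J := mul_right_injective₀ p.2.2
      rw [← tsum_mul_left, ← hinj.tsum_eq]
      · refine tsum_congr fun J ↦ ?_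
        by_cases hJ : J ∈ A <;> simp [hJ, hmul J]
      · intro I hI
        obtain ⟨J, rfl⟩ := (Set.mem_of_indicator_ne_zero hI).2
        exact ⟨J, rfl⟩
    have h := tsum_congr (L := .unconditional _) hsplit
    rw [(hf.indicator _).tsum_add (hf.indicator _), hdvd, ih] at h
    rw [Finset.prod_insert hp]
    linear_combination -h

open Filter Topology in
/-- The Euler product for a completely multiplicative function on ideals, in logarithmic form. -/
theorem Ideal.hasSum_neg_log_one_sub {R : Type*} [CommRing R] [IsDedekindDomain R]
    (f : Ideal R →*₀ ℝ) (hf : Summable f) (hf₀ : ∀ I, 0 ≤ f I)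
    (hf₁ : ∀ p : Ideal R, p.IsPrime → f p < 1) :
    HasSum (fun p : {p : Ideal R // p.IsPrime ∧ p ≠ ⊥} ↦ -Real.log (1 - f p.1))
      (Real.log (∑' I, f I)) := by
  classical
  have hpos : 0 < ∑' I, f I := hf.tsum_pos hf₀ 1 (by rw [map_one]; exact one_pos)
  have hlim : Tendsto (fun S : Finset {p : Ideal R // p.IsPrime ∧ p ≠ ⊥} ↦
      ∑' I, {I : Ideal R | ∀ p ∈ S, ¬ p.1 ∣ I}.indicator f I) atTop (𝓝 1) := by
    have h1 : ∑' I : Ideal R, (if I = 1 then (1 : ℝ) else 0) = 1 := by simp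
    rw [← h1]
    refine tendsto_tsum_of_dominated_convergence hf (fun I ↦ tendsto_const_nhds.congr' ?_) ?_
    · split_ifs with hI
      · refine Eventually.of_forall fun S ↦ ?_
        have : I ∈ {I : Ideal R | ∀ p ∈ S, ¬ p.1 ∣ I} := fun p _ h ↦
          (Ideal.prime_of_isPrime p.2.2 p.2.1).not_isUnit (isUnit_of_dvd_one (hI ▸ h))
        exact ((Set.indicator_of_mem this _).trans (by rw [hI, map_one])).symm
      · by_cases h0 : I = 0
        · exact Eventually.of_forall fun S ↦ by
            rw [h0]
            exact (Set.indicator_apply_eq_zero.mpr fun _ ↦ map_zero f).symm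
        obtain ⟨p, hp, hIp⟩ := Ideal.exists_le_maximal I (by rwa [Ideal.one_eq_top] at hI)
        have hp0 : p ≠ ⊥ := fun h ↦ h0 (le_bot_iff.mp (h ▸ hIp))
        filter_upwards [eventually_ge_atTop {(⟨p, hp.isPrime, hp0⟩ : {p : Ideal R // _})}] with S hS
        refine (Set.indicator_of_notMem (fun h ↦ ?_) _).symm
        exact h _ (hS (Finset.mem_singleton_self _)) (Ideal.dvd_iff_le.mpr hIp)
    · refine Eventually.of_forall fun S I ↦ ?_
      rw [← Real.norm_of_nonneg (hf₀ I)]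
      exact norm_indicator_le_norm_self _ _
  have hprod : Tendsto (fun S : Finset {p : Ideal R // p.IsPrime ∧ p ≠ ⊥} ↦
      ∏ p ∈ S, (1 - f p.1)) atTop (𝓝 (∑' I, f I)⁻¹) := by
    simp_rw [Ideal.tsum_indicator_not_dvd_eq_prod_mul_tsum f hf] at hlim
    simpa [hpos.ne'] using hlim.mul_const (∑' I, f I)⁻¹
  have hlog := ((Real.continuousAt_log (inv_pos.mpr hpos).ne').tendsto.comp hprod).neg
  rw [Real.log_inv, neg_neg] at hlog
  refine hlog.congr fun S ↦ ?_
  rw [Function.comp_apply, Real.log_prod, Finset.sum_neg_distrib]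
  exact fun p _ ↦ (sub_pos.mpr (hf₁ p.1 p.2.1)).ne'

open Filter Topology in
/-- The Dedekind zeta series of a number field converges for `t > 1`. -/
theorem NumberField.summable_absNorm_rpow_neg (K : Type*) [Field K] [NumberField K] {t : ℝ}
    (ht : 1 < t) : Summable fun I : Ideal (𝓞 K) ↦ (Ideal.absNorm I : ℝ) ^ (-t) := by
  set a : ℕ → ℝ := fun n ↦ Nat.card {I : Ideal (𝓞 K) // Ideal.absNorm I = n} with ha
  have hlim : Tendsto (fun n : ℕ ↦ (∑ k ∈ Finset.Icc 1 n, a k) / (n : ℝ)) atTop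
      (𝓝 (dedekindZeta_residue K)) := by
    refine ((Ideal.tendsto_norm_le_div_atTop₀ K).comp tendsto_natCast_atTop_atTop).congr fun n ↦ ?_
    simp only [ha, Function.comp_apply, Nat.cast_le, ← Nat.cast_sum]
    congr
    rw [← add_left_inj 1, ← Ideal.card_norm_le_eq_card_norm_le_add_one,
      show Finset.Icc 1 n = Finset.Ioc 0 n from Finset.Icc_succ_left_eq_Ioc _ _,
      show 1 = Nat.card {I : Ideal (𝓞 K) // Ideal.absNorm I = 0} by
        simp [Ideal.absNorm_eq_zero_iff],
      Finset.sum_Ioc_add_eq_sum_Icc (n.zero_le),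
      ← Finset.card_preimage_eq_sum_card_image_eq
        (fun k _ ↦ Ideal.finite_setOfPred_absNorm_eq k)]
    simp [Set.coe_eq_subtype]
  have hO : (fun n : ℕ ↦ ∑ k ∈ Finset.Icc 1 n, a k) =O[atTop] fun n ↦ (n : ℝ) ^ (1 : ℝ) := by
    simp only [Real.rpow_one]
    refine Asymptotics.isBigO_of_div_tendsto_nhds ?_ _ hlim
    filter_upwards [eventually_ne_atTop 0] with n hn h
    exact absurd (Nat.cast_eq_zero.mp h) hn
  have hL : LSeriesSummable (fun n ↦ (a n : ℂ)) (t : ℂ) :=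
    LSeriesSummable_of_sum_norm_bigO_and_nonneg hO (fun _ ↦ Nat.cast_nonneg _) zero_le_one
      (by simpa using ht)
  rw [← (Equiv.sigmaFiberEquiv (Ideal.absNorm : Ideal (𝓞 K) → ℕ)).summable_iff,
    summable_sigma_of_nonneg fun _ ↦ by dsimp; positivity]
  have hfin (n : ℕ) : Finite {I : Ideal (𝓞 K) // Ideal.absNorm I = n} :=
    (Ideal.finite_setOfPred_absNorm_eq n).to_subtype
  refine ⟨fun n ↦ ?_, hL.norm.congr fun n ↦ ?_⟩
  · have := hfin n
    exact Summable.of_finite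
  · have (I : {I : Ideal (𝓞 K) // Ideal.absNorm I = n}) :
        (Ideal.absNorm I.1 : ℝ) ^ (-t) = (n : ℝ) ^ (-t) := by rw [I.2]
    simp only [Function.comp_apply, Equiv.sigmaFiberEquiv_apply, this, tsum_const, nsmul_eq_mul]
    rcases eq_or_ne n 0 with rfl | hn
    · simp [Real.zero_rpow (by linarith : -t ≠ 0)]
    · rw [LSeries.norm_term_eq, if_neg hn, Complex.norm_real, Complex.ofReal_re,
        Real.norm_of_nonneg (Nat.cast_nonneg _), Real.rpow_neg (Nat.cast_nonneg _), div_eq_mul_inv]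

/-- The completely multiplicative function `I ↦ N(I)^{-t}` on ideals, for `t ≠ 0`. -/
noncomputable def Ideal.absNormRpowNeg (K : Type*) [Field K] [NumberField K] {t : ℝ} (ht : t ≠ 0) :
    Ideal (𝓞 K) →*₀ ℝ where
  toFun I := (Ideal.absNorm I : ℝ) ^ (-t)
  map_zero' := by simp [Real.zero_rpow (neg_ne_zero.mpr ht)]
  map_one' := by simp
  map_mul' I J := by
    simp [Real.mul_rpow]

theorem Ideal.two_le_absNorm_of_isPrime {K : Type*} [Field K] [NumberField K] {p : Ideal (𝓞 K)}
    (hp : p.IsPrime) (hp0 : p ≠ ⊥) : 2 ≤ Ideal.absNorm p := by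
  have h0 : Ideal.absNorm p ≠ 0 := by rwa [Ne, Ideal.absNorm_eq_zero_iff]
  have h1 : Ideal.absNorm p ≠ 1 := by
    rw [Ne, Ideal.absNorm_eq_one_iff]
    exact hp.ne_top
  omega

theorem NumberField.hasSum_neg_log_one_sub_absNorm (K : Type*) [Field K] [NumberField K] {t : ℝ}
    (ht : 1 < t) :
    HasSum (fun p : {p : Ideal (𝓞 K) // p.IsPrime ∧ p ≠ ⊥} ↦
        -Real.log (1 - (Ideal.absNorm p.1 : ℝ) ^ (-t)))
      (Real.log (∑' I : {I : Ideal (𝓞 K) // I ≠ ⊥}, (Ideal.absNorm I.1 : ℝ) ^ (-t))) := by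
  have ht0 : t ≠ 0 := by linarith
  have hsub : ∑' I : {I : Ideal (𝓞 K) // I ≠ ⊥}, (Ideal.absNorm I.1 : ℝ) ^ (-t) =
      ∑' I : Ideal (𝓞 K), (Ideal.absNorm I : ℝ) ^ (-t) := by
    refine tsum_subtype_eq_of_support_subset (s := {I : Ideal (𝓞 K) | I ≠ ⊥})
      (f := fun I : Ideal (𝓞 K) ↦ (Ideal.absNorm I : ℝ) ^ (-t)) fun I hI h ↦ hI ?_
    simp [show I = ⊥ from h, Real.zero_rpow (neg_ne_zero.mpr ht0)]
  rw [hsub]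
  refine Ideal.hasSum_neg_log_one_sub (Ideal.absNormRpowNeg K ht0)
    (summable_absNorm_rpow_neg K ht) (fun I ↦ Real.rpow_nonneg (Nat.cast_nonneg _) _)
    fun p hp ↦ ?_
  by_cases hp0 : p = ⊥
  · rw [hp0, ← Ideal.zero_eq_bot, map_zero]
    exact one_pos
  · have := Ideal.two_le_absNorm_of_isPrime hp hp0
    exact Real.rpow_lt_one_of_one_lt_of_neg (by exact_mod_cast this) (by linarith)

theorem hasSum_pnat_pow_div_neg_log {x : ℝ} (hx : |x| < 1) :
    HasSum (fun k : ℕ+ ↦ x ^ (k : ℕ) / k) (-Real.log (1 - x)) := by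
  rw [← Equiv.pnatEquivNat.symm.hasSum_iff]
  simpa [Function.comp_def] using Real.hasSum_pow_div_log_of_abs_lt_one hx

theorem sum_divisorsAntidiagonal_moebius (m : ℕ+) :
    ∑ q ∈ (m : ℕ).divisorsAntidiagonal, (ArithmeticFunction.moebius q.1 : ℝ) =
      if m = 1 then 1 else 0 := by
  have h := congrArg (fun f : ArithmeticFunction ℤ ↦ ((f m : ℤ) : ℝ))
    (ArithmeticFunction.moebius_mul_coe_zeta)
  simp only [ArithmeticFunction.mul_apply, ArithmeticFunction.one_apply] at h
  push_cast at h
  simp only [PNat.coe_eq_one_iff] at h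
  rw [← h]
  refine Finset.sum_congr rfl fun q hq ↦ ?_
  have := (Nat.mem_divisorsAntidiagonal.mp hq)
  have : q.2 ≠ 0 := fun h0 ↦ m.ne_zero (by rw [← this.1, h0, mul_zero])
  simp [ArithmeticFunction.natCoe_apply, ArithmeticFunction.zeta_apply, this]

/-- Möbius inversion of the logarithmic series. -/
theorem tsum_moebius_div_mul_pow {y : ℝ}
    (hsum : Summable fun q : ℕ+ × ℕ+ ↦
      (ArithmeticFunction.moebius q.1 : ℝ) / q.1 * (y ^ (q.1 * q.2 : ℕ) / q.2)) :
    ∑' q : ℕ+ × ℕ+, (ArithmeticFunction.moebius q.1 : ℝ) / q.1 * (y ^ (q.1 * q.2 : ℕ) / q.2) =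
      y := by
  have hfiber (m : ℕ+) : ∑' q : (m : ℕ).divisorsAntidiagonal,
      (ArithmeticFunction.moebius (sigmaAntidiagonalEquivProd ⟨m, q⟩).1 : ℝ) /
        (sigmaAntidiagonalEquivProd ⟨m, q⟩).1 *
        (y ^ ((sigmaAntidiagonalEquivProd ⟨m, q⟩).1 * (sigmaAntidiagonalEquivProd ⟨m, q⟩).2 : ℕ) /
          (sigmaAntidiagonalEquivProd ⟨m, q⟩).2) = if m = 1 then y else 0 := by
    have hterm (q : (m : ℕ).divisorsAntidiagonal) :
        (ArithmeticFunction.moebius (sigmaAntidiagonalEquivProd ⟨m, q⟩).1 : ℝ) /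
          (sigmaAntidiagonalEquivProd ⟨m, q⟩).1 *
          (y ^ ((sigmaAntidiagonalEquivProd ⟨m, q⟩).1 *
            (sigmaAntidiagonalEquivProd ⟨m, q⟩).2 : ℕ) /
            (sigmaAntidiagonalEquivProd ⟨m, q⟩).2) =
          (fun r : ℕ × ℕ ↦ y ^ (m : ℕ) / m * (ArithmeticFunction.moebius r.1 : ℝ)) q := by
      have h1 : ((sigmaAntidiagonalEquivProd ⟨m, q⟩).1 : ℕ) = q.1.1 := rfl
      have h2 : ((sigmaAntidiagonalEquivProd ⟨m, q⟩).2 : ℕ) = q.1.2 := rfl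
      have hq : q.1.1 * q.1.2 = m := (Nat.mem_divisorsAntidiagonal.mp q.2).1
      rw [h1, h2, hq, div_mul_div_comm, ← Nat.cast_mul, hq]
      ring
    rw [tsum_congr hterm, Finset.tsum_subtype (m : ℕ).divisorsAntidiagonal
      fun r : ℕ × ℕ ↦ y ^ (m : ℕ) / m * (ArithmeticFunction.moebius r.1 : ℝ), ← Finset.mul_sum,
      sum_divisorsAntidiagonal_moebius]
    split_ifs with hm <;> simp [hm]
  have hsum' := sigmaAntidiagonalEquivProd.summable_iff.mpr hsum
  calc _ = _ := (sigmaAntidiagonalEquivProd.tsum_eq _).symm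
    _ = _ := hsum'.tsum_sigma
    _ = _ := tsum_congr hfiber
    _ = y := tsum_ite_eq 1 _

theorem summable_moebius_div_mul_pow {ι : Type*} {y : ι → ℝ} (hy0 : ∀ p, 0 ≤ y p)
    (hy2 : ∀ p, y p ≤ 1 / 2) (hsum : Summable y) :
    Summable fun x : ι × (ℕ+ × ℕ+) ↦
      (ArithmeticFunction.moebius x.2.1 : ℝ) / x.2.1 * (y x.1 ^ (x.2.1 * x.2.2 : ℕ) / x.2.2) := by
  have hgeom : Summable fun n : ℕ+ ↦ (1 / 2 : ℝ) ^ ((n : ℕ) - 1) := by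
    rw [← Equiv.pnatEquivNat.symm.summable_iff]
    simpa [Function.comp_def] using summable_geometric_two
  have hg : Summable fun x : ι × (ℕ+ × ℕ+) ↦
      y x.1 * ((1 / 2 : ℝ) ^ ((x.2.1 : ℕ) - 1) * (1 / 2 : ℝ) ^ ((x.2.2 : ℕ) - 1)) :=
    hsum.mul_of_nonneg (hgeom.mul_of_nonneg hgeom (fun _ ↦ by positivity)
      fun _ ↦ by positivity) hy0 fun _ ↦ by positivity
  refine hg.of_norm_bounded fun ⟨p, n, k⟩ ↦ ?_
  have hμ : ‖(ArithmeticFunction.moebius n : ℝ) / n‖ ≤ 1 := by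
    rw [norm_div, Real.norm_natCast, div_le_one (mod_cast n.pos)]
    have : |(ArithmeticFunction.moebius n : ℝ)| ≤ 1 :=
      mod_cast ArithmeticFunction.abs_moebius_le_one
    exact this.trans (Nat.one_le_cast.mpr n.pos)
  have hpow : ‖y p ^ (n * k : ℕ) / k‖ ≤
      y p * ((1 / 2 : ℝ) ^ ((n : ℕ) - 1) * (1 / 2 : ℝ) ^ ((k : ℕ) - 1)) := by
    have hk : (1 : ℝ) ≤ k := Nat.one_le_cast.mpr k.pos
    rw [Real.norm_of_nonneg (by have := hy0 p; positivity)]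
    refine (div_le_self (pow_nonneg (hy0 p) _) hk).trans ?_
    obtain ⟨a, ha⟩ := Nat.exists_eq_add_of_le' n.pos
    obtain ⟨b, hb⟩ := Nat.exists_eq_add_of_le' k.pos
    rw [ha, hb, Nat.add_sub_cancel, Nat.add_sub_cancel, ← pow_add]
    calc y p ^ ((a + 1) * (b + 1)) ≤ y p ^ (a + b + 1) :=
          pow_le_pow_of_le_one (hy0 p) ((hy2 p).trans (by norm_num))
            (by nlinarith [Nat.zero_le (a * b)])
      _ = y p * y p ^ (a + b) := pow_succ' _ _
      _ ≤ _ := by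
          have := hy0 p
          gcongr
          exact hy2 p
  simpa only [norm_mul, one_mul] using mul_le_mul hμ hpow (norm_nonneg _) zero_le_one

/-- Recovering `∑ p, y p` from the Euler-product logarithms of the powers of `y`. -/
theorem hasSum_moebius_div_mul_of_hasSum_neg_log {ι : Type*} {y : ι → ℝ} (hy0 : ∀ p, 0 ≤ y p)
    (hy2 : ∀ p, y p ≤ 1 / 2) (hsum : Summable y) {L : ℕ+ → ℝ}
    (hL : ∀ n : ℕ+, HasSum (fun p ↦ -Real.log (1 - y p ^ (n : ℕ))) (L n)) :
    HasSum (fun n : ℕ+ ↦ (ArithmeticFunction.moebius n : ℝ) / n * L n) (∑' p, y p) := by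
  let F : ι → ℕ+ → ℕ+ → ℝ := fun p n k ↦
    (ArithmeticFunction.moebius n : ℝ) / n * (y p ^ (n * k : ℕ) / k)
  have hF : Summable fun x : ι × (ℕ+ × ℕ+) ↦ F x.1 x.2.1 x.2.2 :=
    summable_moebius_div_mul_pow hy0 hy2 hsum
  have hp (p : ι) : HasSum (fun q : ℕ+ × ℕ+ ↦ F p q.1 q.2) (y p) := by
    have h : Summable fun q : ℕ+ × ℕ+ ↦ F p q.1 q.2 := hF.prod_factor p
    have ht : ∑' q : ℕ+ × ℕ+, F p q.1 q.2 = y p := tsum_moebius_div_mul_pow h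
    exact ht ▸ h.hasSum
  have hn (n : ℕ+) (p : ι) : HasSum (fun k ↦ F p n k)
      ((ArithmeticFunction.moebius n : ℝ) / n * -Real.log (1 - y p ^ (n : ℕ))) := by
    have hlt : |y p ^ (n : ℕ)| < 1 := by
      rw [abs_of_nonneg (pow_nonneg (hy0 p) _)]
      exact pow_lt_one₀ (hy0 p) ((hy2 p).trans_lt (by norm_num)) n.ne_zero
    refine ((hasSum_pnat_pow_div_neg_log hlt).mul_left
      ((ArithmeticFunction.moebius n : ℝ) / n)).congr_fun fun k ↦ ?_
    simp only [F, pow_mul]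
  clear_value F
  rw [(hF.hasSum.prod_fiberwise hp).tsum_eq]
  let e : ℕ+ × (ι × ℕ+) ≃ ι × (ℕ+ × ℕ+) :=
    ⟨fun x ↦ (x.2.1, x.1, x.2.2), fun x ↦ (x.2.1, x.1, x.2.2), fun _ ↦ rfl, fun _ ↦ rfl⟩
  have hFe : HasSum (fun x : ℕ+ × (ι × ℕ+) ↦ F x.2.1 x.1 x.2.2)
      (∑' x : ι × (ℕ+ × ℕ+), F x.1 x.2.1 x.2.2) := e.hasSum_iff.mpr hF.hasSum
  refine hFe.prod_fiberwise fun n ↦ ?_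
  have h : Summable fun x : ι × ℕ+ ↦ F x.1 n x.2 := hFe.summable.prod_factor n
  have ht := (h.hasSum.prod_fiberwise (hn n)).unique ((hL n).mul_left _)
  exact ht ▸ h.hasSum

/-- Let `K` be a number field with ring of integers `𝓞 K`. For every real
`s > 1`, the series `∑_𝔭 N(𝔭)^{-s}` over nonzero prime ideals and the series
`∑_{n≥1} (μ(n)/n) · log(∑_{I ≠ 0} N(I)^{-ns})` both converge, and they are equal. -/
theorem stmt1 (K : Type*) [Field K] [NumberField K] (s : ℝ) (hs : 1 < s) :
    Summable (fun p : {p : Ideal (𝓞 K) // p.IsPrime ∧ p ≠ ⊥} =>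
      ((Ideal.absNorm p.1 : ℕ) : ℝ) ^ (-s)) ∧
    Summable (fun n : ℕ+ =>
      ((ArithmeticFunction.moebius n : ℤ) : ℝ) / ((n : ℕ) : ℝ) *
        Real.log (∑' I : {I : Ideal (𝓞 K) // I ≠ ⊥},
          ((Ideal.absNorm I.1 : ℕ) : ℝ) ^ (-(((n : ℕ) : ℝ) * s)))) ∧
    (∑' p : {p : Ideal (𝓞 K) // p.IsPrime ∧ p ≠ ⊥}, ((Ideal.absNorm p.1 : ℕ) : ℝ) ^ (-s)) =
      ∑' n : ℕ+, ((ArithmeticFunction.moebius n : ℤ) : ℝ) / ((n : ℕ) : ℝ) *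
        Real.log (∑' I : {I : Ideal (𝓞 K) // I ≠ ⊥},
          ((Ideal.absNorm I.1 : ℕ) : ℝ) ^ (-(((n : ℕ) : ℝ) * s))) := by
  set y : {p : Ideal (𝓞 K) // p.IsPrime ∧ p ≠ ⊥} → ℝ :=
    fun p ↦ (Ideal.absNorm p.1 : ℝ) ^ (-s) with hy
  have hy0 (p) : 0 ≤ y p := Real.rpow_nonneg (Nat.cast_nonneg _) _
  have hy2 (p) : y p ≤ 1 / 2 := by
    have h2 : (2 : ℝ) ≤ Ideal.absNorm p.1 :=
      mod_cast Ideal.two_le_absNorm_of_isPrime p.2.1 p.2.2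
    calc y p ≤ (Ideal.absNorm p.1 : ℝ) ^ (-1 : ℝ) :=
          Real.rpow_le_rpow_of_exponent_le (by linarith) (by linarith)
      _ ≤ 1 / 2 := by
          rw [Real.rpow_neg_one, one_div]
          gcongr
  have hsum : Summable y := (summable_absNorm_rpow_neg K hs).subtype _
  have key := hasSum_moebius_div_mul_of_hasSum_neg_log hy0 hy2 hsum fun n ↦ by
    have hns : 1 < ((n : ℕ) : ℝ) * s :=
      one_lt_mul_of_le_of_lt (Nat.one_le_cast.mpr n.pos) hs
    refine (hasSum_neg_log_one_sub_absNorm K hns).congr_fun fun p ↦ ?_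
    rw [hy, ← Real.rpow_mul_natCast (Nat.cast_nonneg _)]
    rw [neg_mul, mul_comm s]
  exact ⟨hsum, key.summable, key.tsum_eq.symm⟩
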